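/- arXiv:2103.04571 — 2 statements merged into one kernel-verified Lean document; each statement's English description precedes it below -/
import Mathlib

section
/- Fix q ≥ 1, a real q×q matrix Q with Qᵗ = −Q, Q * Qᵗ = (q:ℝ) • 1 − J_q, Q * J_q = J_q * Q = 0, and a real (q+1)×(q+1) matrix S with Sᵗ = −S, S * Sᵗ = (q:ℝ) • 1, zero diagonal, and off-diagonal entries in {1, −1}. For real a, b set 𝒥_1 = b • J_q, 𝒜_1 = a • I_q + b • Q, and let X' be the q × q(q+1) matrix whose block columns, indexed by j ∈ Fin(q+1), are B_0 = 𝒥_1 and B_j = S_{0j} • 𝒜_1 for j ≥ 1 (the first q rows of X_1 = I_{q+1} ⊗ 𝒥_1 + S ⊗ 𝒜_1). Then the (i,j) block (of size q×q) of (X')ᵗ * X' equals: (q b²) • J_q if i = j = 0; (S_{0j} a b) • J_q if i = 0 < j; (S_{0i} a b) • J_q if j = 0 < i; and (S_{0i} S_{0j}) • (a² • I_q + b² • ((q:ℝ) • I_q − J_q)) if i, j ≥ 1. (Hence X_1 is an unfaithful balancedly splittable orthogonal design OD(q(q+1); q, q²).) -/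
open Matrix

/-- The all-ones matrix `J_q`. -/
def Jq (q : ℕ) : Matrix (Fin q) (Fin q) ℝ := Matrix.of fun _ _ => 1

theorem Jq_transpose (q : ℕ) : (Jq q)ᵀ = Jq q := rfl

theorem Jq_mul_Jq (q : ℕ) : Jq q * Jq q = (q : ℝ) • Jq q := by
  ext i j
  simp [Jq, Matrix.mul_apply]

theorem transpose_mul_apply_block {m n ι R : Type*} [Fintype m] [NonUnitalNonAssocSemiring R]
    (X : Matrix m (ι × n) R) (B : ι → Matrix m n R)
    (hX : ∀ r i k, X r (i, k) = B i r k) (i j : ι) (k l : n) :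
    (Xᵀ * X) (i, k) (j, l) = ((B i)ᵀ * B j) k l := by
  simp [Matrix.mul_apply, hX]

theorem transpose_mul_self_of_skew {n : Type*} [Fintype n] [DecidableEq n] {Q : Matrix n n ℝ}
    (hQ : Qᵀ = -Q) (a b : ℝ) :
    (a • (1 : Matrix n n ℝ) + b • Q)ᵀ * (a • (1 : Matrix n n ℝ) + b • Q)
      = a ^ 2 • (1 : Matrix n n ℝ) + b ^ 2 • (Q * Qᵀ) := by
  simp only [transpose_add, transpose_smul, transpose_one, hQ, add_mul, mul_add, smul_mul_assoc,
    mul_smul_comm, one_mul, mul_one, neg_mul, mul_neg]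
  module

/-- The submatrix `X'` formed by the first `q` rows of `X_1 = I_{q+1} ⊗ 𝒥_1 + S ⊗ 𝒜_1`
(block columns `B_0 = 𝒥_1 = b • J_q` and `B_j = S 0 j • 𝒜_1`, `𝒜_1 = a • I_q + b • Q`)
satisfies: the `(i,j)` block of `X'ᵗ * X'` is `(q b²) • J_q` for `i = j = 0`,
`(S 0 j * a * b) • J_q` for `i = 0 < j`, `(S 0 i * a * b) • J_q` for `j = 0 < i`, and
`(S 0 i * S 0 j) • (a² • I_q + b² • (q • I_q - J_q))` for `i, j ≥ 1`.  Hence `X_1` is an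
unfaithful balancedly splittable orthogonal design `OD(q(q+1); q, q²)`. -/
theorem X1_unfaithful_balancedly_splittable (q : ℕ) (hq : 1 ≤ q)
    (Q : Matrix (Fin q) (Fin q) ℝ)
    (hQskew : Qᵀ = -Q)
    (hQQ : Q * Qᵀ = (q : ℝ) • 1 - Jq q)
    (hQJ : Q * Jq q = 0) (hJQ : Jq q * Q = 0)
    (S : Matrix (Fin (q + 1)) (Fin (q + 1)) ℝ)
    (hSskew : Sᵀ = -S) (hSS : S * Sᵀ = (q : ℝ) • 1)
    (hSdiag : ∀ i, S i i = 0)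
    (hSoff : ∀ i j, i ≠ j → S i j = 1 ∨ S i j = -1)
    (a b : ℝ)
    (X' : Matrix (Fin q) (Fin (q + 1) × Fin q) ℝ)
    (hX' : ∀ (i : Fin q) (j : Fin (q + 1)) (l : Fin q),
      X' i (j, l) = if j = 0 then (b • Jq q) i l
        else S 0 j * ((a • (1 : Matrix (Fin q) (Fin q) ℝ) + b • Q) i l)) :
    (∀ k l : Fin q, (X'ᵀ * X') (0, k) (0, l) = (((q : ℝ) * b ^ 2) • Jq q) k l) ∧
    (∀ j : Fin (q + 1), j ≠ 0 → ∀ k l : Fin q,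
      (X'ᵀ * X') (0, k) (j, l) = ((S 0 j * a * b) • Jq q) k l) ∧
    (∀ i : Fin (q + 1), i ≠ 0 → ∀ k l : Fin q,
      (X'ᵀ * X') (i, k) (0, l) = ((S 0 i * a * b) • Jq q) k l) ∧
    (∀ i j : Fin (q + 1), i ≠ 0 → j ≠ 0 → ∀ k l : Fin q,
      (X'ᵀ * X') (i, k) (j, l)
        = ((S 0 i * S 0 j) • (a ^ 2 • (1 : Matrix (Fin q) (Fin q) ℝ)
            + b ^ 2 • ((q : ℝ) • (1 : Matrix (Fin q) (Fin q) ℝ) - Jq q))) k l) := by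
  have hJA : Jq q * (a • (1 : Matrix (Fin q) (Fin q) ℝ) + b • Q) = a • Jq q := by
    simp [mul_add, hJQ]
  have hAJ : (a • (1 : Matrix (Fin q) (Fin q) ℝ) + b • Q)ᵀ * Jq q = a • Jq q := by
    simp [add_mul, hQskew, hQJ]
  have hAA := transpose_mul_self_of_skew hQskew a b
  rw [hQQ] at hAA
  set A := a • (1 : Matrix (Fin q) (Fin q) ℝ) + b • Q
  have hblock := transpose_mul_apply_block X' (fun j => if j = 0 then b • Jq q else S 0 j • A)
    (fun r j l => by rw [hX']; split_ifs <;> simp)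
  refine ⟨fun k l => ?_, fun j hj k l => ?_, fun i hi k l => ?_, fun i j hi hj k l => ?_⟩
  · rw [hblock, if_pos rfl, transpose_smul, Jq_transpose, smul_mul_smul_comm, Jq_mul_Jq, smul_smul]
    simp only [Matrix.smul_apply, smul_eq_mul]
    ring
  · rw [hblock, if_pos rfl, if_neg hj, transpose_smul, Jq_transpose, smul_mul_smul_comm, hJA,
      smul_smul]
    simp only [Matrix.smul_apply, smul_eq_mul]
    ring
  · rw [hblock, if_pos rfl, if_neg hi, transpose_smul, smul_mul_smul_comm, hAJ, smul_smul]
    simp only [Matrix.smul_apply, smul_eq_mul]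
    ring
  · rw [hblock, if_neg hi, if_neg hj, transpose_smul, smul_mul_smul_comm, hAA]
end

section
/- Fix q ≥ 1, a real symmetric q×q matrix Q with Qᵗ = Q, Q * Qᵗ = (q:ℝ) • 1 − J_q, Q * J_q = J_q * Q = 0, and a real (q+1)×(q+1) matrix S with Sᵗ = S and S * Sᵗ = (q:ℝ) • 1. For real a, b define 𝒞_m, 𝒟_m recursively by 𝒞_0 = (a), 𝒟_0 = (b), 𝒞_{m+1} = J_q ⊗ 𝒟_m, 𝒟_{m+1} = I_q ⊗ 𝒞_m + (Complex.I • Q) ⊗ 𝒟_m, and set Y_m := Complex.I • (I_{q+1} ⊗ 𝒞_m) + S ⊗ 𝒟_m, a square complex matrix of order q^m (q+1). Then Y_m * Y_mᴴ = (q^m * a^2 + q^{m+1} * b^2) • 1. (Thus Y_m is a complex orthogonal design COD(q^m(q+1); q^m, q^{m+1}).) -/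
open Matrix Kronecker

/-- Index type for the recursively defined matrices of order `q^m`. -/
def idx (q : ℕ) : ℕ → Type
  | 0 => Fin 1
  | m + 1 => Fin q × idx q m

instance idxFintype (q : ℕ) : (m : ℕ) → Fintype (idx q m)
  | 0 => inferInstanceAs (Fintype (Fin 1))
  | m + 1 => haveI := idxFintype q m; inferInstanceAs (Fintype (Fin q × idx q m))

instance idxDecEq (q : ℕ) : (m : ℕ) → DecidableEq (idx q m)
  | 0 => inferInstanceAs (DecidableEq (Fin 1))
  | m + 1 => haveI := idxDecEq q m; inferInstanceAs (DecidableEq (Fin q × idx q m))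

/-- The complex all-ones matrix `J_q`. -/
def JqC (q : ℕ) : Matrix (Fin q) (Fin q) ℂ := Matrix.of fun _ _ => 1

/-- The pair `(𝒞_m, 𝒟_m)` of complex matrices defined recursively by `𝒞_0 = (a)`,
`𝒟_0 = (b)`, `𝒞_{m+1} = J_q ⊗ 𝒟_m`, `𝒟_{m+1} = I_q ⊗ 𝒞_m + (i Q) ⊗ 𝒟_m`. -/
def CD (q : ℕ) (Q : Matrix (Fin q) (Fin q) ℝ) (a b : ℝ) :
    (m : ℕ) → Matrix (idx q m) (idx q m) ℂ × Matrix (idx q m) (idx q m) ℂ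
  | 0 => (Matrix.of fun _ _ => (a : ℂ), Matrix.of fun _ _ => (b : ℂ))
  | m + 1 =>
      (JqC q ⊗ₖ (CD q Q a b m).2,
       (1 : Matrix (Fin q) (Fin q) ℂ) ⊗ₖ (CD q Q a b m).1
         + (Complex.I • Q.map (Complex.ofReal)) ⊗ₖ (CD q Q a b m).2)


/-- The complexification of a real symmetric matrix is Hermitian. -/
lemma conjTranspose_map_ofReal_of_symm {n : Type*} {A : Matrix n n ℝ} (hA : Aᵀ = A) :
    (A.map Complex.ofReal)ᴴ = A.map Complex.ofReal := by
  ext i j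
  have h : A j i = A i j := congrFun (congrFun hA i) j
  simp [h]

lemma map_ofReal_mul {l m n : Type*} [Fintype m] (A : Matrix l m ℝ) (B : Matrix m n ℝ) :
    A.map Complex.ofReal * B.map Complex.ofReal = (A * B).map Complex.ofReal :=
  (Matrix.map_mul (f := Complex.ofRealHom)).symm

lemma JqC_eq_map (q : ℕ) :
    JqC q = (Matrix.of fun _ _ => (1 : ℝ) : Matrix (Fin q) (Fin q) ℝ).map Complex.ofReal := by
  ext i j
  simp [JqC]

lemma conjTranspose_JqC (q : ℕ) : (JqC q)ᴴ = JqC q := by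
  ext i j
  simp [JqC]

lemma JqC_mul_JqC (q : ℕ) : JqC q * JqC q = (q : ℂ) • JqC q := by
  ext i j
  simp [JqC, Matrix.mul_apply]

section Step

variable {n : Type*} [Fintype n] {q : ℕ} {R : Matrix (Fin q) (Fin q) ℂ}
  {C D : Matrix n n ℂ}

/-- The symmetry `C Dᴴ = D Cᴴ` passes to the next pair of the recursion. -/
lemma mul_conjTranspose_comm_step (hR : Rᴴ = R) (hJR : JqC q * R = 0) (hRJ : R * JqC q = 0)
    (hCD : C * Dᴴ = D * Cᴴ) :
    (JqC q ⊗ₖ D) * ((1 : Matrix (Fin q) (Fin q) ℂ) ⊗ₖ C + (Complex.I • R) ⊗ₖ D)ᴴ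
      = ((1 : Matrix (Fin q) (Fin q) ℂ) ⊗ₖ C + (Complex.I • R) ⊗ₖ D) * (JqC q ⊗ₖ D)ᴴ := by
  simp only [conjTranspose_add, conjTranspose_kronecker, conjTranspose_smul, conjTranspose_one,
    conjTranspose_JqC, hR, Matrix.mul_add, Matrix.add_mul, ← mul_kronecker_mul, Matrix.mul_smul,
    Matrix.smul_mul, hJR, hRJ, hCD, Matrix.mul_one, Matrix.one_mul, smul_zero, zero_kronecker]

/-- The identity `C Cᴴ + q D Dᴴ = c` passes to the next pair of the recursion, with `c`
multiplied by `q`. -/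
lemma mul_conjTranspose_add_step [DecidableEq n] (hR : Rᴴ = R) (hRR : R * R = (q : ℂ) • 1 - JqC q)
    (hCD : C * Dᴴ = D * Cᴴ) {c : ℂ} (hc : C * Cᴴ + (q : ℂ) • (D * Dᴴ) = c • 1) :
    (JqC q ⊗ₖ D) * (JqC q ⊗ₖ D)ᴴ
        + (q : ℂ) • (((1 : Matrix (Fin q) (Fin q) ℂ) ⊗ₖ C + (Complex.I • R) ⊗ₖ D)
          * ((1 : Matrix (Fin q) (Fin q) ℂ) ⊗ₖ C + (Complex.I • R) ⊗ₖ D)ᴴ)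
      = ((q : ℂ) * c) • 1 := by
  have hCC : C * Cᴴ = c • 1 - (q : ℂ) • (D * Dᴴ) := eq_sub_of_add_eq hc
  simp only [conjTranspose_add, conjTranspose_kronecker, conjTranspose_smul, conjTranspose_one,
    conjTranspose_JqC, hR, Matrix.mul_add, Matrix.add_mul, ← mul_kronecker_mul, Matrix.mul_smul,
    Matrix.smul_mul, hRR, hCD, hCC, Matrix.mul_one, Matrix.one_mul, JqC_mul_JqC]
  rw [← one_kronecker_one]
  ext ⟨i, k⟩ ⟨j, l⟩
  simp only [Matrix.add_apply, Matrix.smul_apply, Matrix.sub_apply, kroneckerMap_apply,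
    smul_eq_mul, RCLike.star_def, Complex.conj_I]
  linear_combination (-(q : ℂ) * ((q : ℂ) * (1 : Matrix (Fin q) (Fin q) ℂ) i j - JqC q i j)
    * (D * Dᴴ) k l) * Complex.I_mul_I

end Step

/-- If `C Dᴴ = D Cᴴ` and `C Cᴴ + s D Dᴴ = c`, and `S` is Hermitian with `S² = s`, then
`i (I ⊗ C) + S ⊗ D` times its conjugate transpose is the scalar `c`. -/
lemma smul_one_kronecker_add_mul_conjTranspose {n p : Type*} [Fintype n] [DecidableEq n]
    [Fintype p] [DecidableEq p] {S : Matrix p p ℂ} {C D : Matrix n n ℂ} {s c : ℂ}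
    (hS : Sᴴ = S) (hSS : S * S = s • 1) (hCD : C * Dᴴ = D * Cᴴ)
    (hc : C * Cᴴ + s • (D * Dᴴ) = c • 1) :
    (Complex.I • ((1 : Matrix p p ℂ) ⊗ₖ C) + S ⊗ₖ D)
      * (Complex.I • ((1 : Matrix p p ℂ) ⊗ₖ C) + S ⊗ₖ D)ᴴ = c • 1 := by
  have hCC : C * Cᴴ = c • 1 - s • (D * Dᴴ) := eq_sub_of_add_eq hc
  simp only [conjTranspose_add, conjTranspose_kronecker, conjTranspose_smul, conjTranspose_one,
    hS, Matrix.mul_add, Matrix.add_mul, ← mul_kronecker_mul, Matrix.mul_smul,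
    Matrix.smul_mul, hSS, hCD, hCC, Matrix.mul_one, Matrix.one_mul]
  rw [← one_kronecker_one]
  ext ⟨i, k⟩ ⟨j, l⟩
  simp only [Matrix.add_apply, Matrix.smul_apply, Matrix.sub_apply, kroneckerMap_apply,
    smul_eq_mul, RCLike.star_def, Complex.conj_I]
  linear_combination (-(1 : Matrix p p ℂ) i j
    * (c * (1 : Matrix n n ℂ) k l - s * (D * Dᴴ) k l)) * Complex.I_mul_I

/-- The two invariants of the recursion defining `(𝒞_m, 𝒟_m)`. -/
lemma CD_invariants {q : ℕ} {Q : Matrix (Fin q) (Fin q) ℝ} (hQsymm : Qᵀ = Q)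
    (hQQ : Q * Qᵀ = (q : ℝ) • 1 - Matrix.of fun _ _ => (1 : ℝ))
    (hQJ : Q * (Matrix.of fun _ _ => (1 : ℝ)) = 0)
    (hJQ : (Matrix.of fun _ _ => (1 : ℝ)) * Q = 0) (a b : ℝ) (m : ℕ) :
    (CD q Q a b m).1 * (CD q Q a b m).2ᴴ = (CD q Q a b m).2 * (CD q Q a b m).1ᴴ ∧
      (CD q Q a b m).1 * (CD q Q a b m).1ᴴ + (q : ℂ) • ((CD q Q a b m).2 * (CD q Q a b m).2ᴴ)
        = ((q : ℂ) ^ m * a ^ 2 + (q : ℂ) ^ (m + 1) * b ^ 2) • 1 := by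
  have hR := conjTranspose_map_ofReal_of_symm hQsymm
  have hJR : JqC q * Q.map Complex.ofReal = 0 := by
    rw [JqC_eq_map, map_ofReal_mul, hJQ]
    exact Matrix.map_zero _ Complex.ofReal_zero
  have hRJ : Q.map Complex.ofReal * JqC q = 0 := by
    rw [JqC_eq_map, map_ofReal_mul, hQJ]
    exact Matrix.map_zero _ Complex.ofReal_zero
  have hRR : Q.map Complex.ofReal * Q.map Complex.ofReal = (q : ℂ) • 1 - JqC q := by
    rw [hQsymm] at hQQ
    rw [map_ofReal_mul, hQQ]
    ext i j
    by_cases h : i = j <;> simp [JqC, h]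
  induction m with
  | zero =>
    constructor
    · change (of fun _ _ => (a : ℂ) : Matrix (Fin 1) (Fin 1) ℂ)
          * (of fun _ _ => (b : ℂ) : Matrix (Fin 1) (Fin 1) ℂ)ᴴ
        = (of fun _ _ => (b : ℂ) : Matrix (Fin 1) (Fin 1) ℂ)
          * (of fun _ _ => (a : ℂ) : Matrix (Fin 1) (Fin 1) ℂ)ᴴ
      ext i j
      simp [Matrix.mul_apply, mul_comm]
    · change (of fun _ _ => (a : ℂ) : Matrix (Fin 1) (Fin 1) ℂ)
          * (of fun _ _ => (a : ℂ) : Matrix (Fin 1) (Fin 1) ℂ)ᴴ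
        + (q : ℂ) • ((of fun _ _ => (b : ℂ) : Matrix (Fin 1) (Fin 1) ℂ)
          * (of fun _ _ => (b : ℂ) : Matrix (Fin 1) (Fin 1) ℂ)ᴴ)
        = ((q : ℂ) ^ 0 * a ^ 2 + (q : ℂ) ^ (0 + 1) * b ^ 2) • (1 : Matrix (Fin 1) (Fin 1) ℂ)
      ext i j
      simp [Matrix.mul_apply, Subsingleton.elim i j, sq]
  | succ m ih =>
    refine ⟨mul_conjTranspose_comm_step hR hJR hRJ ih.1, ?_⟩
    have hscalar : (q : ℂ) ^ (m + 1) * a ^ 2 + (q : ℂ) ^ (m + 1 + 1) * b ^ 2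
        = (q : ℂ) * ((q : ℂ) ^ m * a ^ 2 + (q : ℂ) ^ (m + 1) * b ^ 2) := by ring
    rw [hscalar]
    exact mul_conjTranspose_add_step hR hRR ih.1 ih.2

/-- `Y_m = i • (I_{q+1} ⊗ 𝒞_m) + S ⊗ 𝒟_m` is a complex orthogonal design
`COD(q^m(q+1); q^m, q^{m+1})`: `Y_m * Y_mᴴ = (q^m a² + q^{m+1} b²) • 1`. -/
theorem Ym_complex_orthogonal_design (q : ℕ) (hq : 1 ≤ q) (Q : Matrix (Fin q) (Fin q) ℝ)
    (hQsymm : Qᵀ = Q)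
    (hQQ : Q * Qᵀ = (q : ℝ) • 1 - Matrix.of fun _ _ => (1 : ℝ))
    (hQJ : Q * (Matrix.of fun _ _ => (1 : ℝ)) = 0)
    (hJQ : (Matrix.of fun _ _ => (1 : ℝ)) * Q = 0)
    (S : Matrix (Fin (q + 1)) (Fin (q + 1)) ℝ)
    (hSsymm : Sᵀ = S) (hSS : S * Sᵀ = (q : ℝ) • 1)
    (a b : ℝ) :
    ∀ m : ℕ,
      (Complex.I • ((1 : Matrix (Fin (q + 1)) (Fin (q + 1)) ℂ) ⊗ₖ (CD q Q a b m).1)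
          + S.map (Complex.ofReal) ⊗ₖ (CD q Q a b m).2)
        * (Complex.I • ((1 : Matrix (Fin (q + 1)) (Fin (q + 1)) ℂ) ⊗ₖ (CD q Q a b m).1)
            + S.map (Complex.ofReal) ⊗ₖ (CD q Q a b m).2)ᴴ
      = ((q : ℝ) ^ m * a ^ 2 + (q : ℝ) ^ (m + 1) * b ^ 2) • 1 := by
  intro m
  obtain ⟨hCD, hc⟩ := CD_invariants hQsymm hQQ hQJ hJQ a b m
  have hSS' : S.map Complex.ofReal * S.map Complex.ofReal = (q : ℂ) • 1 := by
    rw [hSsymm] at hSS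
    rw [map_ofReal_mul, hSS]
    ext i j
    by_cases h : i = j <;> simp [h]
  rw [smul_one_kronecker_add_mul_conjTranspose (conjTranspose_map_ofReal_of_symm hSsymm) hSS'
    hCD hc]
  ext i j
  simp [Matrix.smul_apply]
end
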